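/- Fix an integer n ≥ 1 and positive integers a, b, c with a ≠ b, n·c ≠ a, and n·c ≠ b. Define Z_n ⊆ ℙ(ℂ⁴) × ℙ(ℂ²) as the set of pairs ([z], [w]) with z 2 · (w 1)^n = z 3 · (w 0)^n, and let the circle act by g • ([z], [w]) := ([(g^a·z 0, g^b·z 1, z 2, g^{nc}·z 3)], [(w 0, g^c·w 1)]). Then the set of points of Z_n fixed by every element of the circle group is exactly the six points { ([e₀],[u₀]), ([e₀],[u₁]), ([e₁],[u₀]), ([e₁],[u₁]), ([e₂],[u₀]), ([e₃],[u₁]) }, where eᵢ ∈ Fin 4 → ℂ and uⱼ ∈ Fin 2 → ℂ are the standard basis vectors. (This is the fixed point set computation of Example 3.3: the action on Z_n has exactly 6 fixed points q₁,…,q₆.) -/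

import Mathlib

/-- The 6-dimensional analogue `Z_n` of the Hirzebruch surfaces (Example 3.3), as the
subset of `ℙ(ℂ⁴) × ℙ(ℂ²)` of pairs `([z], [w])` with `z 2 · (w 1)^n = z 3 · (w 0)^n`
(a condition independent of the choice of nonzero representatives). -/
def Zn (n : ℕ) :
    Set (Projectivization ℂ (Fin 4 → ℂ) × Projectivization ℂ (Fin 2 → ℂ)) :=
  {P | ∀ (z : Fin 4 → ℂ) (hz : z ≠ 0) (w : Fin 2 → ℂ) (hw : w ≠ 0),
    Projectivization.mk ℂ z hz = P.1 → Projectivization.mk ℂ w hw = P.2 →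
      z 2 * w 1 ^ n = z 3 * w 0 ^ n}

/-- The circle action of Example 3.3 on the `ℙ(ℂ⁴)`-representatives:
`g • z = (gᵃ·z 0, gᵇ·z 1, z 2, g^{nc}·z 3)`. -/
noncomputable def actZ (n a b c : ℕ) (g : Circle) (z : Fin 4 → ℂ) : Fin 4 → ℂ :=
  fun i => (g : ℂ) ^ (![a, b, 0, n * c] i) * z i

/-- The circle action of Example 3.3 on the `ℙ(ℂ²)`-representatives:
`g • w = (w 0, g^c·w 1)`. -/
noncomputable def actW (c : ℕ) (g : Circle) (w : Fin 2 → ℂ) : Fin 2 → ℂ :=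
  fun i => (g : ℂ) ^ (![0, c] i) * w i

/-- The `i`-th standard basis vector of `ℂ⁴` is nonzero. -/
lemma e_ne_zero (i : Fin 4) : (Pi.single i 1 : Fin 4 → ℂ) ≠ 0 := by
  intro h
  have := congrFun h i
  simp at this

/-- The `j`-th standard basis vector of `ℂ²` is nonzero. -/
lemma u_ne_zero (j : Fin 2) : (Pi.single j 1 : Fin 2 → ℂ) ≠ 0 := by
  intro h
  have := congrFun h j
  simp at this

/-- The coordinate point `[eᵢ] ∈ ℙ(ℂ⁴)`. -/
noncomputable def mkE (i : Fin 4) : Projectivization ℂ (Fin 4 → ℂ) :=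
  Projectivization.mk ℂ (Pi.single i 1) (e_ne_zero i)

/-- The coordinate point `[uⱼ] ∈ ℙ(ℂ²)`. -/
noncomputable def mkU (j : Fin 2) : Projectivization ℂ (Fin 2 → ℂ) :=
  Projectivization.mk ℂ (Pi.single j 1) (u_ne_zero j)

lemma aux_circle {p q : ℕ} (h : ∀ g : Circle, (g : ℂ) ^ p = (g : ℂ) ^ q) : p = q := by
  wlog hlt : p < q generalizing p q
  · rcases Nat.lt_trichotomy p q with h1 | h1 | h1
    · exact absurd h1 hlt
    · exact h1
    · exact (this (fun g => (h g).symm) h1).symm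
  exfalso
  obtain ⟨d, rfl⟩ := Nat.exists_eq_add_of_lt hlt
  have h1 := h (Circle.exp (Real.pi / (d + 1)))
  have hne : ((Circle.exp (Real.pi / (d + 1)) : Circle) : ℂ) ^ p ≠ 0 :=
    pow_ne_zero _ (Circle.coe_ne_zero _)
  rw [add_assoc, pow_add] at h1
  have h2 : ((Circle.exp (Real.pi / (d + 1)) : Circle) : ℂ) ^ (d + 1) = 1 := by
    have := mul_left_cancel₀ hne ((mul_one _).trans h1)
    exact this.symm
  rw [Circle.coe_exp, ← Complex.exp_nat_mul] at h2
  have h3 : ((d + 1 : ℕ) : ℂ) * (((Real.pi / (d + 1) : ℝ) : ℂ) * Complex.I)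
      = Real.pi * Complex.I := by
    have : (d : ℂ) + 1 ≠ 0 := by exact_mod_cast Nat.succ_ne_zero d
    push_cast
    field_simp
  rw [h3, Complex.exp_pi_mul_I] at h2
  norm_num at h2

lemma aux_single {m : ℕ} (k : Fin m → ℕ) (hk : Function.Injective k) (z : Fin m → ℂ) (hz : z ≠ 0)
    (h : ∀ g : Circle, ∃ u : ℂ, u • z = fun i => (g : ℂ) ^ k i * z i) :
    ∃ i, ∃ u : ℂ, u • (Pi.single i 1 : Fin m → ℂ) = z := by
  obtain ⟨i, hi⟩ := Function.ne_iff.1 hz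
  simp only [Pi.zero_apply] at hi
  refine ⟨i, z i, ?_⟩
  funext j
  by_cases hj : j = i
  · subst hj; simp
  · simp only [Pi.smul_apply, Pi.single_eq_of_ne hj, smul_zero]
    by_contra hzj
    apply hj
    apply hk
    apply aux_circle
    intro g
    obtain ⟨u, hu⟩ := h g
    have h1 := congrFun hu i
    have h2 := congrFun hu j
    simp only [Pi.smul_apply, smul_eq_mul] at h1 h2
    rw [← mul_right_cancel₀ hi h1, ← mul_right_cancel₀ (Ne.symm hzj) h2]

lemma aux_act_ne {m : ℕ} (k : Fin m → ℕ) (z : Fin m → ℂ) (hz : z ≠ 0) (g : Circle) :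
    (fun i => (g : ℂ) ^ k i * z i) ≠ 0 := by
  obtain ⟨i, hi⟩ := Function.ne_iff.1 hz
  exact Function.ne_iff.2 ⟨i, mul_ne_zero (pow_ne_zero _ (Circle.coe_ne_zero _)) hi⟩

lemma aux_fixed {m : ℕ} (k : Fin m → ℕ) (z : Fin m → ℂ) (hz : z ≠ 0) (g : Circle) (i : Fin m)
    (hs : (Pi.single i 1 : Fin m → ℂ) ≠ 0)
    (hz' : (fun i => (g : ℂ) ^ k i * z i) ≠ 0)
    (h : Projectivization.mk ℂ z hz = Projectivization.mk ℂ (Pi.single i 1) hs) :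
    Projectivization.mk ℂ (fun i => (g : ℂ) ^ k i * z i) hz'
      = Projectivization.mk ℂ (Pi.single i 1) hs := by
  rw [Projectivization.mk_eq_mk_iff'] at h ⊢
  obtain ⟨u, rfl⟩ := h
  refine ⟨(g : ℂ) ^ k i * u, ?_⟩
  funext j
  by_cases hj : j = i
  · subst hj; simp
  · simp [Pi.single_eq_of_ne hj]

lemma aux_mem (n : ℕ) (hn : 1 ≤ n) (i : Fin 4) (j : Fin 2) :
    (mkE i, mkU j) ∈ Zn n ↔ ¬ (i = 2 ∧ j = 1) ∧ ¬ (i = 3 ∧ j = 0) := by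
  have hn0 : n ≠ 0 := by omega
  constructor
  · intro h
    have := h _ (e_ne_zero i) _ (u_ne_zero j) rfl rfl
    constructor
    · rintro ⟨rfl, rfl⟩
      simp [hn0] at this
    · rintro ⟨rfl, rfl⟩
      simp [hn0] at this
  · intro h z hz w hw h1 h2
    simp only [mkE, mkU, Projectivization.mk_eq_mk_iff'] at h1 h2
    obtain ⟨u, rfl⟩ := h1
    obtain ⟨v, rfl⟩ := h2
    fin_cases i <;> fin_cases j <;> simp_all

/-- Fixed point set computation of Example 3.3: for `n ≥ 1` and positive integers
`a, b, c` with `a ≠ b`, `nc ≠ a`, `nc ≠ b`, the set of points of `Z_n` fixed by every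
element of the circle group is exactly the six points
`([e₀],[u₀]), ([e₀],[u₁]), ([e₁],[u₀]), ([e₁],[u₁]), ([e₂],[u₀]), ([e₃],[u₁])`. -/
theorem stmt15 (n a b c : ℕ) (hn : 1 ≤ n) (ha : 0 < a) (hb : 0 < b) (hc : 0 < c)
    (hab : a ≠ b) (hnca : n * c ≠ a) (hncb : n * c ≠ b) :
    {P : Projectivization ℂ (Fin 4 → ℂ) × Projectivization ℂ (Fin 2 → ℂ) |
        P ∈ Zn n ∧
        ∀ (g : Circle) (z : Fin 4 → ℂ) (hz : z ≠ 0) (w : Fin 2 → ℂ) (hw : w ≠ 0)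
          (hz' : actZ n a b c g z ≠ 0) (hw' : actW c g w ≠ 0),
          (Projectivization.mk ℂ z hz, Projectivization.mk ℂ w hw) = P →
            (Projectivization.mk ℂ (actZ n a b c g z) hz',
              Projectivization.mk ℂ (actW c g w) hw') = P}
      = {(mkE 0, mkU 0), (mkE 0, mkU 1), (mkE 1, mkU 0),
         (mkE 1, mkU 1), (mkE 2, mkU 0), (mkE 3, mkU 1)} := by
  have hnc : 0 < n * c := Nat.mul_pos hn hc
  have kZ : Function.Injective ![a, b, 0, n * c] := by
    intro i j hij
    fin_cases i <;> fin_cases j <;> simp at hij ⊢ <;> omega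
  have kW : Function.Injective ![0, c] := by
    intro i j hij
    fin_cases i <;> fin_cases j <;> simp at hij ⊢ <;> omega
  have key : ∀ P : Projectivization ℂ (Fin 4 → ℂ) × Projectivization ℂ (Fin 2 → ℂ),
      P ∈ ({(mkE 0, mkU 0), (mkE 0, mkU 1), (mkE 1, mkU 0),
         (mkE 1, mkU 1), (mkE 2, mkU 0), (mkE 3, mkU 1)} : Set _) ↔
      ∃ i j, P = (mkE i, mkU j) ∧ (¬ (i = 2 ∧ j = 1) ∧ ¬ (i = 3 ∧ j = 0)) := by
    intro P
    constructor
    · rintro (h | h | h | h | h | h)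
      · exact ⟨0, 0, h, by decide⟩
      · exact ⟨0, 1, h, by decide⟩
      · exact ⟨1, 0, h, by decide⟩
      · exact ⟨1, 1, h, by decide⟩
      · exact ⟨2, 0, h, by decide⟩
      · exact ⟨3, 1, h, by decide⟩
    · rintro ⟨i, j, rfl, h⟩
      fin_cases i <;> fin_cases j <;> simp at h ⊢
  ext P
  rw [key]
  constructor
  · rintro ⟨hP, hfix⟩
    obtain ⟨P1, P2⟩ := P
    induction P1 using Projectivization.ind with | h z hz =>
    induction P2 using Projectivization.ind with | h w hw =>
    have hf := fun g => Prod.ext_iff.1 (hfix g z hz w hw (aux_act_ne _ z hz g) (aux_act_ne _ w hw g) rfl)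
    obtain ⟨i, hi⟩ := aux_single _ kZ z hz
      (fun g => (Projectivization.mk_eq_mk_iff' ℂ _ _ _ _).1 (hf g).1)
    obtain ⟨j, hj⟩ := aux_single _ kW w hw
      (fun g => (Projectivization.mk_eq_mk_iff' ℂ _ _ _ _).1 (hf g).2)
    have e1 : Projectivization.mk ℂ z hz = mkE i :=
      (Projectivization.mk_eq_mk_iff' ℂ _ _ _ _).2 hi
    have e2 : Projectivization.mk ℂ w hw = mkU j :=
      (Projectivization.mk_eq_mk_iff' ℂ _ _ _ _).2 hj
    rw [e1, e2] at hP ⊢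
    exact ⟨i, j, rfl, (aux_mem n hn i j).1 hP⟩
  · rintro ⟨i, j, rfl, h⟩
    refine ⟨(aux_mem n hn i j).2 h, ?_⟩
    intro g z hz w hw hz' hw' he
    obtain ⟨h1, h2⟩ := Prod.ext_iff.1 he
    exact Prod.ext (aux_fixed _ z hz g i (e_ne_zero i) hz' h1)
      (aux_fixed _ w hw g j (u_ne_zero j) hw' h2)
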